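/- arXiv:1909.12378 — 3 statements merged into one kernel-verified Lean document; each statement's English description precedes it below -/
import Mathlib

section
/- Let d ≥ 1, let B ∈ M_d(ℂ) be diagonalizable, i.e. there exists an invertible S ∈ M_d(ℂ) such that S⁻¹BS is diagonal, and set b := max{Re λ : λ is a complex eigenvalue of B}. Let E ∈ M_{d²}(ℂ) satisfy ‖(S⁻¹ ⊗ S⁻¹) E (S ⊗ S)‖₂ < −2b. Then every complex eigenvalue μ of B ⊗ I_d + I_d ⊗ B + E satisfies Re μ < 0; in particular, B ⊗ I_d + I_d ⊗ B + E is invertible. -/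
open Matrix Kronecker

/-- The operator norm on square complex matrices induced by the Euclidean vector norm. -/
noncomputable def l2OpNorm {m : Type*} [Fintype m] [DecidableEq m] (M : Matrix m m ℂ) : ℝ :=
  ‖Matrix.toEuclideanCLM (𝕜 := ℂ) M‖

theorem aux_pert {m : Type*} [Fintype m] [DecidableEq m] (w : m → ℂ) (F : Matrix m m ℂ) (c : ℝ)
    (hw : ∀ p, (w p).re ≤ -c) (hF : l2OpNorm F < c) (μ : ℂ)
    (hμ : μ ∈ spectrum ℂ (Matrix.diagonal w + F)) : μ.re < 0 := by
  by_contra hneg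
  push Not at hneg
  have hc : 0 < c := lt_of_le_of_lt (norm_nonneg _) hF
  rw [← Matrix.spectrum_toLin', ← Module.End.hasEigenvalue_iff_mem_spectrum] at hμ
  obtain ⟨x, hx⟩ := hμ.exists_hasEigenvector
  have hx0 := hx.2
  have he := hx.apply_eq_smul
  rw [Matrix.toLin'_apply, Matrix.add_mulVec] at he
  have hp : ∀ p, (F *ᵥ x) p = (μ - w p) * x p := by
    intro p
    have := congrFun he p
    simp only [Pi.add_apply, Matrix.mulVec_diagonal, Pi.smul_apply, smul_eq_mul] at this
    linear_combination this
  have hge : ∀ p, c * ‖x p‖ ≤ ‖(F *ᵥ x) p‖ := by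
    intro p
    rw [hp, norm_mul]
    refine mul_le_mul_of_nonneg_right ?_ (norm_nonneg _)
    have h1 := Complex.re_le_norm (μ - w p)
    rw [Complex.sub_re] at h1
    linarith [hw p]
  set y : EuclideanSpace ℂ m := WithLp.toLp 2 x with hy
  have hy0 : 0 < ‖y‖ := by
    rw [norm_pos_iff]
    intro h
    apply hx0
    ext p
    exact congrArg (fun z : EuclideanSpace ℂ m => z p) h
  have h2 : ‖Matrix.toEuclideanCLM (𝕜 := ℂ) F y‖ ≤ l2OpNorm F * ‖y‖ :=
    ContinuousLinearMap.le_opNorm _ _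
  have h3 : c * ‖y‖ ≤ ‖Matrix.toEuclideanCLM (𝕜 := ℂ) F y‖ := by
    refine (sq_le_sq₀ (by positivity) (norm_nonneg _)).1 ?_
    rw [mul_pow, EuclideanSpace.norm_sq_eq, EuclideanSpace.norm_sq_eq, Finset.mul_sum]
    refine Finset.sum_le_sum fun p _ => ?_
    rw [← mul_pow]
    exact pow_le_pow_left₀ (by positivity) (hge p) 2
  nlinarith

theorem stmt1 {d : ℕ} (hd : 1 ≤ d)
    (B : Matrix (Fin d) (Fin d) ℂ)
    (S : Matrix (Fin d) (Fin d) ℂ) (hS : IsUnit S) (hdiag : (S⁻¹ * B * S).IsDiag)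
    (E : Matrix (Fin d × Fin d) (Fin d × Fin d) ℂ)
    (hE : l2OpNorm ((S⁻¹ ⊗ₖ S⁻¹) * E * (S ⊗ₖ S)) <
      -2 * sSup (Complex.re '' spectrum ℂ B)) :
    (∀ μ ∈ spectrum ℂ (B ⊗ₖ (1 : Matrix (Fin d) (Fin d) ℂ) +
        (1 : Matrix (Fin d) (Fin d) ℂ) ⊗ₖ B + E), μ.re < 0) ∧
      IsUnit (B ⊗ₖ (1 : Matrix (Fin d) (Fin d) ℂ) +
        (1 : Matrix (Fin d) (Fin d) ℂ) ⊗ₖ B + E) := by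
  have main : ∀ μ ∈ spectrum ℂ (B ⊗ₖ (1 : Matrix (Fin d) (Fin d) ℂ) +
        (1 : Matrix (Fin d) (Fin d) ℂ) ⊗ₖ B + E), μ.re < 0 := by
    have hdet : IsUnit S.det := (Matrix.isUnit_iff_isUnit_det S).1 hS
    have h1 : S * S⁻¹ = 1 := Matrix.mul_nonsing_inv S hdet
    have h2 : S⁻¹ * S = 1 := Matrix.nonsing_inv_mul S hdet
    let u : (Matrix (Fin d) (Fin d) ℂ)ˣ := ⟨S, S⁻¹, h1, h2⟩
    let U : (Matrix (Fin d × Fin d) (Fin d × Fin d) ℂ)ˣ :=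
      ⟨S ⊗ₖ S, S⁻¹ ⊗ₖ S⁻¹, by rw [← Matrix.mul_kronecker_mul, h1, Matrix.one_kronecker_one],
        by rw [← Matrix.mul_kronecker_mul, h2, Matrix.one_kronecker_one]⟩
    obtain ⟨v, hv⟩ : ∃ v, S⁻¹ * B * S = Matrix.diagonal v := ⟨_, hdiag.diagonal_diag.symm⟩
    have hsp : spectrum ℂ B = Set.range v := by
      rw [← spectrum_diagonal (R := ℂ) v, ← hv]
      exact (spectrum.units_conjugate' (u := u)).symm
    have hb : ∀ i, (v i).re ≤ sSup (Complex.re '' spectrum ℂ B) := by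
      intro i
      apply le_csSup
      · rw [hsp]
        exact ((Set.finite_range v).image _).bddAbove
      · rw [hsp]
        exact ⟨v i, ⟨i, rfl⟩, rfl⟩
    intro μ hμ
    rw [← spectrum.units_conjugate' (u := U)] at hμ
    refine aux_pert (fun p : Fin d × Fin d => v p.1 + v p.2) _ _ ?_ hE μ ?_
    · intro p
      rw [Complex.add_re]
      linarith [hb p.1, hb p.2]
    · convert hμ using 1
      change _ = spectrum ℂ ((S⁻¹ ⊗ₖ S⁻¹) * _ * (S ⊗ₖ S))
      congr 1
      rw [Matrix.mul_add, Matrix.mul_add, Matrix.add_mul, Matrix.add_mul]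
      congr 1
      simp only [← Matrix.mul_kronecker_mul, Matrix.mul_one, h2, hv]
      ext ⟨i, j⟩ ⟨k, l⟩
      simp only [Matrix.add_apply, Matrix.kroneckerMap_apply, Matrix.diagonal_apply,
        Matrix.one_apply, Prod.mk.injEq]
      by_cases hik : i = k <;> by_cases hjl : j = l <;> simp [hik, hjl]
  refine ⟨main, ?_⟩
  by_contra h
  have := main 0 (spectrum.zero_mem ℂ h)
  simp at this
end

section
/- Let d ≥ 1 and let A, Ã ∈ M_d(ℝ) be matrices such that: there exists j ∈ {1,…,d} with A_{1,1} = ⋯ = A_{1,j−1} = 0 and A_{1,j} > 0, and there exists j̃ ∈ {1,…,d} with Ã_{1,1} = ⋯ = Ã_{1,j̃−1} = 0 and Ã_{1,j̃} > 0. If A X Aᵀ = Ã X Ãᵀ for every symmetric matrix X ∈ M_d(ℝ), then A = Ã. -/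
open Matrix

theorem stmt5 {d : ℕ} (hd : 0 < d) (A A' : Matrix (Fin d) (Fin d) ℝ)
    (j : Fin d) (hj0 : ∀ k : Fin d, k < j → A ⟨0, hd⟩ k = 0) (hj : 0 < A ⟨0, hd⟩ j)
    (j' : Fin d) (hj0' : ∀ k : Fin d, k < j' → A' ⟨0, hd⟩ k = 0) (hj' : 0 < A' ⟨0, hd⟩ j')
    (h : ∀ X : Matrix (Fin d) (Fin d) ℝ, X.IsSymm → A * X * Aᵀ = A' * X * A'ᵀ) :
    A = A' := by
  have entry : ∀ (B : Matrix (Fin d) (Fin d) ℝ) (p q i k : Fin d),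
      (B * (Matrix.single p q (1:ℝ) + Matrix.single q p 1 : Matrix (Fin d) (Fin d) ℝ) * Bᵀ : Matrix (Fin d) (Fin d) ℝ) i k = B i p * B k q + B i q * B k p := by
    intro B p q i k
    have e : ∀ p q : Fin d, (B * Matrix.single p q (1:ℝ) * Bᵀ : Matrix (Fin d) (Fin d) ℝ) i k = B i p * B k q := by
      intro p q
      rw [Matrix.mul_apply, Finset.sum_eq_single q]
      · simp
      · intro b _ hb
        rw [Matrix.mul_single_apply_of_ne _ _ _ _ _ hb, zero_mul]
      · simp
    rw [Matrix.mul_add, Matrix.add_mul, Matrix.add_apply, e, e]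
  have key : ∀ p q i k : Fin d,
      A i p * A k q + A i q * A k p = A' i p * A' k q + A' i q * A' k p := by
    intro p q i k
    rw [← entry, ← entry, h]
    simp [Matrix.IsSymm, Matrix.transpose_add, add_comm]
  generalize (⟨0, hd⟩ : Fin d) = z at *
  have hjj : j = j' := by
    rcases lt_trichotomy j j' with hl | hl | hl
    · have h1 := key j j z z
      rw [hj0' j hl] at h1
      nlinarith
    · exact hl
    · have h1 := key j' j' z z
      rw [hj0 j' hl] at h1
      nlinarith
  subst hjj
  have e0 : A z j = A' z j := by
    have h1 := key j j z z
    nlinarith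
  have e1 : ∀ q, A z q = A' z q := by
    intro q
    have h1 := key j q z z
    rw [← e0] at h1
    apply mul_left_cancel₀ hj.ne'
    linarith
  have e2 : ∀ k, A k j = A' k j := by
    intro k
    have h1 := key j j z k
    rw [← e0] at h1
    apply mul_left_cancel₀ hj.ne'
    linarith
  ext k q
  have h1 := key j q z k
  rw [← e0, ← e1 q, ← e2 k] at h1
  apply mul_left_cancel₀ hj.ne'
  linarith
end

section
/- Let d ≥ 2, let σ_L > 0 be a real number, and fix indices k ≠ l in {1,…,d}. Let A, A', B, B' ∈ M_d(ℝ) be such that A_{k,l} > 0, A_{k,l} ≠ A_{l,k}, B_{k,l} = B_{l,k}, and likewise A'_{k,l} > 0, A'_{k,l} ≠ A'_{l,k}, B'_{k,l} = B'_{l,k}. If B ⊗ I_d + I_d ⊗ B + σ_L (A ⊗ A) = B' ⊗ I_d + I_d ⊗ B' + σ_L (A' ⊗ A'), then A = A' and B = B'. -/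
open Matrix Kronecker

theorem stmt6 {d : ℕ} (hd : 2 ≤ d) (σL : ℝ) (hσL : 0 < σL)
    (k l : Fin d) (hkl : k ≠ l)
    (A A' B B' : Matrix (Fin d) (Fin d) ℝ)
    (hA : 0 < A k l) (hAkl : A k l ≠ A l k) (hBkl : B k l = B l k)
    (hA' : 0 < A' k l) (hAkl' : A' k l ≠ A' l k) (hBkl' : B' k l = B' l k)
    (heq : B ⊗ₖ (1 : Matrix (Fin d) (Fin d) ℝ) + (1 : Matrix (Fin d) (Fin d) ℝ) ⊗ₖ B +
        σL • (A ⊗ₖ A) =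
      B' ⊗ₖ (1 : Matrix (Fin d) (Fin d) ℝ) + (1 : Matrix (Fin d) (Fin d) ℝ) ⊗ₖ B' +
        σL • (A' ⊗ₖ A')) :
    A = A' ∧ B = B' := by
  have H : ∀ i j p q : Fin d,
      B i j * (1 : Matrix (Fin d) (Fin d) ℝ) p q + (1 : Matrix (Fin d) (Fin d) ℝ) i j * B p q
        + σL * (A i j * A p q) =
      B' i j * (1 : Matrix (Fin d) (Fin d) ℝ) p q + (1 : Matrix (Fin d) (Fin d) ℝ) i j * B' p q
        + σL * (A' i j * A' p q) := by
    intro i j p q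
    have h := congrFun (congrFun heq (i, p)) (j, q)
    simpa [Matrix.kroneckerMap_apply, Matrix.add_apply, Matrix.smul_apply] using h
  have hoff : ∀ i j p q : Fin d, i ≠ j → p ≠ q → A i j * A p q = A' i j * A' p q := by
    intro i j p q hij hpq
    have h := H i j p q
    rw [Matrix.one_apply_ne hij, Matrix.one_apply_ne hpq] at h
    apply mul_left_cancel₀ hσL.ne'
    linarith
  have hdg : ∀ i j p : Fin d, i ≠ j →
      B i j + σL * (A i j * A p p) = B' i j + σL * (A' i j * A' p p) := by
    intro i j p hij
    have h := H i j p p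
    rw [Matrix.one_apply_ne hij, Matrix.one_apply_eq] at h
    linarith
  have hkl1 : A k l = A' k l := by
    have h := hoff k l k l hkl hkl
    nlinarith
  have hAoff : ∀ i j : Fin d, i ≠ j → A i j = A' i j := by
    intro i j hij
    have h := hoff i j k l hij hkl
    rw [← hkl1] at h
    exact mul_right_cancel₀ hA.ne' h
  have hAd : ∀ p : Fin d, A p p = A' p p := by
    intro p
    have h1 := hdg k l p hkl
    have h2 := hdg l k p hkl.symm
    rw [← hAoff k l hkl] at h1
    rw [← hAoff l k hkl.symm] at h2
    have h3 : σL * (A k l - A l k) ≠ 0 := mul_ne_zero hσL.ne' (sub_ne_zero.mpr hAkl)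
    apply mul_left_cancel₀ h3
    linarith
  have hAA : A = A' := by
    ext i j
    by_cases h : i = j
    · subst h
      exact hAd i
    · exact hAoff i j h
  refine ⟨hAA, ?_⟩
  subst hAA
  ext i j
  by_cases hij : i = j
  · subst hij
    have h := H i i i i
    rw [Matrix.one_apply_eq] at h
    linarith
  · have h := hdg i j i hij
    linarith
end
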